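/- For every x ∈ L^×, all entries of the matrix k·a(x)·k⁻¹ lie in the subfield K if and only if x^{q+1} = 1. -/

import Mathlib

/-- An element of a field lies in a finite subfield `K` iff it is fixed by the `#K`-power map. -/
theorem Subfield.mem_iff_pow_card_eq_self {L : Type*} [Field L] (K : Subfield L) [Fintype K]
    (y : L) : y ∈ K ↔ y ^ Fintype.card K = y := by
  classical
  refine ⟨fun hy => congrArg Subtype.val (FiniteField.pow_card (⟨y, hy⟩ : K)), fun hy => ?_⟩
  by_contra hyK
  have hcard : 1 < Fintype.card K := Fintype.one_lt_card
  have hne := FiniteField.X_pow_card_sub_X_ne_zero L hcard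
  let S : Finset L := Finset.univ.image (Subtype.val : K → L)
  have hyS : y ∉ S := by
    simp only [S, Finset.mem_image, Finset.mem_univ, true_and, not_exists]
    rintro a rfl
    exact hyK a.2
  have hsub : (insert y S).val ⊆ (Polynomial.X ^ Fintype.card K - Polynomial.X :
      Polynomial L).roots := by
    intro z hz
    have hz' : z ^ Fintype.card K = z := by
      rcases Finset.mem_insert.1 (show z ∈ insert y S from hz) with rfl | hz
      · exact hy
      · obtain ⟨a, -, rfl⟩ := Finset.mem_image.1 hz
        exact congrArg Subtype.val (FiniteField.pow_card a)
    simp [Polynomial.mem_roots hne, hz']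
  have hle := Polynomial.card_le_degree_of_subset_roots hsub
  rw [FiniteField.X_pow_card_sub_X_natDegree_eq L hcard, Finset.card_insert_of_notMem hyS,
    Finset.card_image_of_injective _ Subtype.val_injective, Finset.card_univ] at hle
  omega

/-- k·a(x)·k⁻¹ has all entries in K iff x^{q+1} = 1. -/
theorem stmt6 (q : ℕ) (hq : IsPrimePow q) (hodd : Odd q)
    (L : Type) [Field L] (K : Subfield L)
    (hcardL : Nat.card L = q ^ 2) (hcardK : Nat.card K = q)
    (e : L) (heK : e ∈ K) (hns : ¬ ∃ s ∈ K, s ^ 2 = e)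
    (et : L) (het : et ^ 2 = e)
    (k : Matrix (Fin 2) (Fin 2) L) (hk : k = !![1, -et⁻¹; et, 1])
    (x : L) (hx : x ≠ 0) :
    (∀ i j, (k * !![x, 0; 0, x⁻¹] * k⁻¹) i j ∈ K) ↔ x ^ (q + 1) = 1 := by
  have : Finite K := Nat.finite_of_card_ne_zero (hcardK ▸ hq.ne_zero)
  have : Fintype K := Fintype.ofFinite K
  rw [Nat.card_eq_fintype_card] at hcardK
  have hmem (y : L) : y ∈ K ↔ y ^ q = y := hcardK ▸ K.mem_iff_pow_card_eq_self y
  have hadd (a b : L) : (a + b) ^ q = a ^ q + b ^ q :=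
    hcardK ▸ map_add (FiniteField.frobeniusAlgHom K L) a b
  have hsub (a b : L) : (a - b) ^ q = a ^ q - b ^ q :=
    hcardK ▸ map_sub (FiniteField.frobeniusAlgHom K L) a b
  have het0 : et ≠ 0 := by
    rintro rfl
    exact hns ⟨0, K.zero_mem, het⟩
  have hetq : et ^ q = -et := by
    have hsq : (et ^ q) ^ 2 = et ^ 2 := by
      rw [← pow_mul, mul_comm, pow_mul, het, (hmem e).1 heK]
    exact (sq_eq_sq_iff_eq_or_eq_neg.1 hsq).resolve_left
      fun h => hns ⟨et, (hmem et).2 h, het⟩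
  have h2 : (2 : L) ≠ 0 := by
    intro h
    have hneg : -et = et := by linear_combination -et * h
    exact hns ⟨et, (hmem et).2 (hetq.trans hneg), het⟩
  have h2K : (2 : L) ∈ K := ofNat_mem K 2
  have hinv : k⁻¹ = !![2⁻¹, 2⁻¹ * et⁻¹; -(2⁻¹ * et), 2⁻¹] := by
    apply Matrix.inv_eq_right_inv
    rw [hk]
    ext i j
    fin_cases i <;> fin_cases j <;> simp [Matrix.mul_apply, Fin.sum_univ_two] <;>
      field_simp <;> ring
  have hprod : k * !![x, 0; 0, x⁻¹] * k⁻¹ =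
      !![(x + x⁻¹) / 2, et * (x - x⁻¹) / e / 2; et * (x - x⁻¹) / 2, (x + x⁻¹) / 2] := by
    rw [hinv, hk, ← het]
    ext i j
    fin_cases i <;> fin_cases j <;> simp [Matrix.mul_apply, Fin.sum_univ_two] <;>
      field_simp <;> ring
  have hentries : (∀ i j, (k * !![x, 0; 0, x⁻¹] * k⁻¹) i j ∈ K) ↔
      x + x⁻¹ ∈ K ∧ et * (x - x⁻¹) ∈ K := by
    rw [hprod]
    constructor
    · intro h
      have h00 : (x + x⁻¹) / 2 ∈ K := h 0 0
      have h10 : et * (x - x⁻¹) / 2 ∈ K := h 1 0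
      exact ⟨div_mul_cancel₀ (x + x⁻¹) h2 ▸ K.mul_mem h00 h2K,
        div_mul_cancel₀ (et * (x - x⁻¹)) h2 ▸ K.mul_mem h10 h2K⟩
    · rintro ⟨hs, hd⟩ i j
      fin_cases i <;> fin_cases j
      · exact K.div_mem hs h2K
      · exact K.div_mem (K.div_mem hd heK) h2K
      · exact K.div_mem hd h2K
      · exact K.div_mem hs h2K
  rw [hentries, hmem, hmem, hadd, mul_pow, hsub, hetq, inv_pow, pow_succ,
    mul_eq_one_iff_eq_inv₀ hx]
  constructor
  · rintro ⟨hs, hd⟩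
    have hd' : -(x ^ q - (x ^ q)⁻¹) = x - x⁻¹ :=
      mul_left_cancel₀ het0 (by linear_combination hd)
    exact mul_left_cancel₀ h2 (by linear_combination hs - hd')
  · intro h
    rw [h, inv_inv]
    exact ⟨add_comm _ _, by ring⟩
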